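/- Let ε > 0, r > 0, and ε₁ = 16·(2(ε/r + ε²/r²) + 2ε/((4+ε₁)r)) be small; more simply: for r > 0, ε₁ ∈ (0,1), and ε' > 0 with 16ε' ≤ ε₁, the point c = (r/2 + ε, r/2 + ε, r/(4+ε₁) + ε) in R³ with ε chosen so that ε' = 2(ε/r + ε²/r²) + 2ε/((4+ε₁)r) satisfies: the Euclidean distance from c to the origin is at most r(3+ε₁)/(4+ε₁). -/

import Mathlib

/-- Key estimate for the lower bound construction for balls in `ℝ³`: for `r > 0`,
`ε₁ ∈ (0,1)`, `ε > 0`, with `ε' = 2(ε/r + ε²/r²) + 2ε/((4+ε₁)r)` and `16ε' ≤ ε₁`, the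
point `c = (r/2+ε, r/2+ε, r/(4+ε₁)+ε)` has Euclidean norm at most `r(3+ε₁)/(4+ε₁)`. -/
theorem stmt13 (r ε ε₁ ε' : ℝ) (hr : 0 < r) (hε : 0 < ε)
    (hε₁0 : 0 < ε₁) (hε₁1 : ε₁ < 1)
    (hε' : ε' = 2 * (ε / r + ε ^ 2 / r ^ 2) + 2 * ε / ((4 + ε₁) * r))
    (h16 : 16 * ε' ≤ ε₁) :
    Real.sqrt ((r / 2 + ε) ^ 2 + (r / 2 + ε) ^ 2 + (r / (4 + ε₁) + ε) ^ 2) ≤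
      r * (3 + ε₁) / (4 + ε₁) := by
  obtain ⟨x, rfl⟩ : ∃ x, ε = x * r := ⟨ε / r, by field_simp⟩
  obtain ⟨t, ht⟩ : ∃ t, t = (4 + ε₁)⁻¹ := ⟨_, rfl⟩
  have hx : 0 < x := pos_of_mul_pos_left hε hr.le
  have ht0 : 0 < t := by rw [ht]; positivity
  have ht1 : t * (4 + ε₁) = 1 := by rw [ht]; field_simp
  have hε'x : ε' = 2 * (x + x ^ 2) + 2 * x * t := by
    rw [hε', ht]; field_simp
  have hrhs : r * (3 + ε₁) / (4 + ε₁) = r * (1 - t) := by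
    rw [ht]; field_simp; ring
  have htε : ε₁ / 10 ≤ 1 / 2 - 2 * t := by
    have h5 : 1 / 5 ≤ t := by nlinarith
    nlinarith
  have hxt : 0 < x * t := mul_pos hx ht0
  have key : 1 / 2 + t ^ 2 + ε' + x ^ 2 ≤ (1 - t) ^ 2 := by nlinarith
  rw [hrhs, div_eq_mul_inv r (4 + ε₁), ← ht]
  apply Real.sqrt_le_iff.mpr
  refine ⟨mul_nonneg hr.le (by linarith), ?_⟩
  calc (r / 2 + x * r) ^ 2 + (r / 2 + x * r) ^ 2 + (r * t + x * r) ^ 2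
      = r ^ 2 * (1 / 2 + t ^ 2 + ε' + x ^ 2) := by rw [hε'x]; ring
    _ ≤ r ^ 2 * (1 - t) ^ 2 := by gcongr
    _ = (r * (1 - t)) ^ 2 := by ring
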